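/- For every Artin algebra A, the weak resolution dimension of A equals the extension dimension of A: wrd(A) = ed(A). -/

import Mathlib

universe u

open CategoryTheory

namespace Paper

variable (A : Type u) [Ring A]

/-- `X` belongs to `add 𝒮`: it is a direct summand of a finite direct sum of members of `𝒮`. -/
def memAdd (S : Set (ModuleCat.{u} A)) (X : ModuleCat.{u} A) : Prop :=
  ∃ (n : ℕ) (M : Fin n → ModuleCat.{u} A) (Y : ModuleCat.{u} A),
    (∀ i, M i ∈ S) ∧ Nonempty ((X × Y) ≃ₗ[A] ((i : Fin n) → M i))

/-- `add T` for a single module `T`. -/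
def addOf (T : ModuleCat.{u} A) : Set (ModuleCat.{u} A) :=
  {X | memAdd A {T} X}

/-- `0 → X → Y → Z → 0` is a short exact sequence. -/
def IsSES {X Y Z : ModuleCat.{u} A} (f : X →ₗ[A] Y) (g : Y →ₗ[A] Z) : Prop :=
  Function.Injective f ∧ Function.Surjective g ∧ LinearMap.range f = LinearMap.ker g

/-- The extension product `𝒮 • 𝒯` of two classes of modules. -/
def bullet (S T : Set (ModuleCat.{u} A)) : Set (ModuleCat.{u} A) :=
  {X | memAdd A {W | Module.Finite A W ∧
    ∃ (T₁ T₂ : ModuleCat.{u} A) (f : T₁ →ₗ[A] W) (g : W →ₗ[A] T₂),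
      T₁ ∈ S ∧ T₂ ∈ T ∧ IsSES A f g} X}

/-- `[T]ₙ`. -/
def bracket (T : ModuleCat.{u} A) : ℕ → Set (ModuleCat.{u} A)
  | 0 => {X | Subsingleton X}
  | 1 => addOf A T
  | (n+2) => bullet A (addOf A T) (bracket T (n+1))

/-- The extension dimension of `A`. -/
noncomputable def extDim : ℕ∞ :=
  sInf {d : ℕ∞ | ∃ n : ℕ, d = n ∧ ∃ T : ModuleCat.{u} A, Module.Finite A T ∧
    ∀ X : ModuleCat.{u} A, Module.Finite A X → X ∈ bracket A T (n + 1)}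

/-- There is an exact sequence `0 → M_n → ⋯ → M_0 → X → 0` with all `M_i ∈ add M`. -/
def ResLen (M : ModuleCat.{u} A) : ModuleCat.{u} A → ℕ → Prop
  | X, 0 => X ∈ addOf A M
  | X, (n+1) => ∃ (M₀ : ModuleCat.{u} A) (g : M₀ →ₗ[A] X),
      M₀ ∈ addOf A M ∧ Function.Surjective g ∧
        ResLen M (ModuleCat.of A (LinearMap.ker g)) n

/-- `M`-wrd(X) ≤ n : there is an exact sequence `0 → M_n → ⋯ → M_0 → X ⊕ Y → 0`
with all `M_i ∈ add M`. -/
def wrdLE (M X : ModuleCat.{u} A) (n : ℕ) : Prop :=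
  ∃ Y : ModuleCat.{u} A, Module.Finite A Y ∧ ResLen A M (ModuleCat.of A (X × Y)) n

/-- The weak `M`-resolution dimension of `X`. -/
noncomputable def wrdMod (M X : ModuleCat.{u} A) : ℕ∞ :=
  sInf {d : ℕ∞ | ∃ n : ℕ, d = n ∧ wrdLE A M X n}

/-- The weak `M`-resolution dimension of the algebra `A`. -/
noncomputable def wrdAlg (M : ModuleCat.{u} A) : ℕ∞ :=
  sSup {d : ℕ∞ | ∃ X : ModuleCat.{u} A, Module.Finite A X ∧ d = wrdMod A M X}

/-- The weak resolution dimension of `A`. -/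
noncomputable def wrd : ℕ∞ :=
  sInf {d : ℕ∞ | ∃ M : ModuleCat.{u} A, Module.Finite A M ∧ d = wrdAlg A M}

end Paper

namespace Paper

section InjectiveEnvelope

variable {A : Type u} [Ring A]

/-- `f : L → E` is an essential monomorphism. -/
def IsEssential {L E : Type u} [AddCommGroup L] [Module A L] [AddCommGroup E] [Module A E]
    (f : L →ₗ[A] E) : Prop :=
  Function.Injective f ∧ ∀ x : E, x ≠ 0 → ∃ a : A, a • x ≠ 0 ∧ a • x ∈ LinearMap.range f

theorem IsEssential.comp {L E F : Type u} [AddCommGroup L] [Module A L] [AddCommGroup E]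
    [Module A E] [AddCommGroup F] [Module A F] {f : L →ₗ[A] E} {g : E →ₗ[A] F}
    (hg : IsEssential g) (hf : IsEssential f) : IsEssential (g ∘ₗ f) := by
  refine ⟨hg.1.comp hf.1, fun x hx => ?_⟩
  obtain ⟨a, hax, y, hy⟩ := hg.2 x hx
  have hy0 : y ≠ 0 := by rintro rfl; exact hax (by rw [← hy, map_zero])
  obtain ⟨b, hby, z, hz⟩ := hf.2 y hy0
  have hba : (b * a) • x = g (b • y) := by rw [mul_smul, ← hy, map_smul]
  refine ⟨b * a, ?_, z, ?_⟩
  · rw [hba]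
    exact fun h => hby (hg.1 (by rw [h, map_zero]))
  · rw [hba, LinearMap.comp_apply, hz]

theorem IsEssential.mem_range_of_jacobson_smul [IsSemiprimaryRing A] {L E : Type u}
    [AddCommGroup L] [Module A L] [AddCommGroup E] [Module A E] {f : L →ₗ[A] E}
    (hf : IsEssential f) {x : E} (hx : ∀ j ∈ Ring.jacobson A, j • x = 0) :
    x ∈ LinearMap.range f := by
  let N : Submodule A E :=
    { carrier := {x | ∀ j ∈ Ring.jacobson A, j • x = 0}
      add_mem' := fun ha hb j hj => by rw [smul_add, ha j hj, hb j hj, add_zero]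
      zero_mem' := fun j _ => smul_zero j
      smul_mem' := fun c x hx j hj => by
        rw [← mul_smul]
        exact hx _ (Ideal.mul_mem_right c _ hj) }
  have hN : Module.IsTorsionBySet A N (Ring.jacobson A) := fun y j =>
    Subtype.ext (y.2 j.1 j.2)
  have : IsSemisimpleModule A N := by
    let := hN.module
    exact hN.isSemisimpleModule_iff.1 inferInstance
  obtain ⟨K, hK⟩ := exists_isCompl ((LinearMap.range f).comap N.subtype)
  have hbot : K = ⊥ := by
    refine (Submodule.eq_bot_iff _).2 fun y hy => by_contra fun hy0 => ?_
    obtain ⟨a, ha, ha'⟩ := hf.2 (y : E) (fun h => hy0 (Subtype.ext h))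
    have := Submodule.disjoint_def.1 hK.disjoint (a • y) ha' (K.smul_mem a hy)
    exact ha (by simpa using congrArg Subtype.val this)
  have htop := hK.codisjoint.eq_top
  rw [hbot, sup_bot_eq] at htop
  have : (⟨x, hx⟩ : N) ∈ (LinearMap.range f).comap N.subtype := htop ▸ Submodule.mem_top
  exact this

theorem exists_length_annihilated_le (k : Type u) [CommRing k] [IsArtinianRing k] [Algebra k A]
    [Module.Finite k A]
    (L : Type u) [AddCommGroup L] [Module A L] [Module k L]
    [IsScalarTower k A L] [Module.Finite A L] (i : ℕ) :
    ∃ B : ℕ, ∀ (E : Type u) [AddCommGroup E] [Module A E] [Module k E] [IsScalarTower k A E]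
      (f : L →ₗ[A] E), IsEssential f → ∀ N : Submodule k E,
        (∀ x ∈ N, ∀ j ∈ Ring.jacobson A ^ i, j • x = 0) → Module.length k N ≤ B := by
  have : IsArtinianRing A := isArtinian_of_tower k inferInstance
  have : Module.Finite k L := Module.Finite.trans A L
  obtain ⟨ℓ, hℓ⟩ := ENat.ne_top_iff_exists.1 (Module.length_ne_top (R := k) (M := L))
  induction i with
  | zero =>
    refine ⟨0, fun E _ _ _ _ f _ N hN => ?_⟩
    have : Subsingleton N := ⟨fun x y => Subtype.ext <| by
      have h : ∀ z ∈ N, z = 0 := fun z hz => by simpa using hN z hz 1 (by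
        rw [Submodule.pow_zero, Ideal.one_eq_top]; exact Submodule.mem_top)
      rw [h x x.2, h y y.2]⟩
    simp
  | succ i ih =>
    obtain ⟨B, hB⟩ := ih
    obtain ⟨s, hs⟩ : ((Ring.jacobson A).restrictScalars k).FG := IsNoetherian.noetherian _
    refine ⟨ℓ + s.card * B, fun E _ _ _ _ f hf N hN => ?_⟩
    have hsJ : ∀ b ∈ s, b ∈ Ring.jacobson A := fun b hb => by
      have : b ∈ (Ring.jacobson A).restrictScalars k := hs ▸ Submodule.subset_span hb
      exact this
    let Ei : Submodule k E :=
      { carrier := {x | ∀ j ∈ Ring.jacobson A ^ i, j • x = 0}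
        add_mem' := fun ha hb j hj => by rw [smul_add, ha j hj, hb j hj, add_zero]
        zero_mem' := fun j _ => smul_zero j
        smul_mem' := fun c x hx j hj => by rw [smul_comm, hx j hj, smul_zero] }
    let φ : N →ₗ[k] (s → Ei) := LinearMap.pi fun b =>
      LinearMap.codRestrict Ei ((Algebra.lsmul k k E (b : A)).comp N.subtype) fun x j hj => by
        have := hN x x.2 (j * b) (by
          rw [Submodule.pow_succ]
          exact Ideal.mul_mem_mul hj (hsJ b b.2))
        simpa [mul_smul] using this
    have hφ : ∀ x : N, φ x = 0 → (x : E) ∈ LinearMap.range f := fun x hx => by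
      refine hf.mem_range_of_jacobson_smul fun j hj => ?_
      have hj' : j ∈ Submodule.span k (s : Set A) := by rw [hs]; exact hj
      induction hj' using Submodule.span_induction with
      | mem b hb => exact congrArg Subtype.val (congrFun hx ⟨b, hb⟩)
      | zero => exact zero_smul _ _
      | add a b ha hb iha ihb =>
        have e1 := iha (by rw [← Submodule.restrictScalars_mem k, ← hs]; exact ha)
        have e2 := ihb (by rw [← Submodule.restrictScalars_mem k, ← hs]; exact hb)
        rw [add_smul, e1, e2, add_zero]
      | smul c a ha iha =>
        have e1 := iha (by rw [← Submodule.restrictScalars_mem k, ← hs]; exact ha)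
        rw [smul_assoc, e1, smul_zero]
    have hker : Module.length k (LinearMap.ker φ) ≤ ℓ := by
      let fk := f.restrictScalars k
      let ψ : LinearMap.ker φ →ₗ[k] LinearMap.range fk :=
        LinearMap.codRestrict _ (N.subtype.comp (LinearMap.ker φ).subtype) fun x => by
          obtain ⟨y, hy⟩ := hφ x x.2
          exact ⟨y, hy⟩
      have hψ : Function.Injective ψ := fun x y h =>
        Subtype.ext (Subtype.ext (congrArg (fun z : LinearMap.range fk => (z : E)) h))
      calc Module.length k (LinearMap.ker φ) ≤ Module.length k (LinearMap.range fk) :=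
            Module.length_le_of_injective ψ hψ
        _ ≤ Module.length k L :=
            Module.length_le_of_surjective _ fk.surjective_rangeRestrict
        _ = ℓ := hℓ.symm
    have hrange : Module.length k (LinearMap.range φ) ≤ (s.card * B : ℕ) := by
      calc Module.length k (LinearMap.range φ) ≤ Module.length k (s → Ei) :=
            Module.length_le_of_injective _ (LinearMap.range φ).injective_subtype
        _ ≤ (s.card * B : ℕ) := by
            rw [Module.length_pi_of_fintype]
            refine (Finset.sum_le_sum fun _ _ => hB E f hf Ei fun x hx => hx).trans ?_
            simp
    rw [Module.length_eq_add_of_exact (LinearMap.ker φ).subtype φ.rangeRestrict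
      (Submodule.subtype_injective _) φ.surjective_rangeRestrict
      (by rw [LinearMap.exact_iff, LinearMap.ker_rangeRestrict, Submodule.range_subtype])]
    push_cast at hrange ⊢
    exact add_le_add hker hrange

theorem exists_length_essential_le (k : Type u) [CommRing k] [IsArtinianRing k] [Algebra k A]
    [Module.Finite k A]
    (L : ModuleCat.{u} A) [Module.Finite A L] :
    ∃ B : ℕ, ∀ (E : ModuleCat.{u} A) (f : L →ₗ[A] E), IsEssential f → Module.length A E ≤ B := by
  have : IsArtinianRing A := isArtinian_of_tower k inferInstance
  let : Module k L := Module.compHom L (algebraMap k A)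
  have : IsScalarTower k A L := ⟨fun c a x => by
    rw [Algebra.smul_def, mul_smul]; rfl⟩
  obtain ⟨n, hn⟩ := IsSemiprimaryRing.isNilpotent (R := A)
  obtain ⟨B, hB⟩ := exists_length_annihilated_le (A := A) k L n
  refine ⟨B, fun E f hf => ?_⟩
  let : Module k E := Module.compHom E (algebraMap k A)
  have : IsScalarTower k A E := ⟨fun c a x => by
    rw [Algebra.smul_def, mul_smul]; rfl⟩
  have h1 := Submodule.length_le_length_restrictScalars k (⊤ : Submodule A E)
  rw [Module.length_top] at h1
  refine h1.trans (hB E f hf _ fun x _ j hj => ?_)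
  have : j = 0 := by
    rw [hn] at hj
    exact hj
  rw [this, zero_smul]

/-- Every finitely generated module over an Artin algebra embeds in a finitely generated injective
module. -/
theorem exists_finite_injective (k : Type u) [CommRing k] [IsArtinianRing k] [Algebra k A]
    [Module.Finite k A]
    (L : ModuleCat.{u} A) [Module.Finite A L] :
    ∃ (E : ModuleCat.{u} A) (f : L →ₗ[A] E),
      Module.Finite A E ∧ Module.Injective A E ∧ Function.Injective f := by
  obtain ⟨B, hB⟩ := exists_length_essential_le k L
  let S : Set ℕ := {n | ∃ (E : ModuleCat.{u} A) (f : L →ₗ[A] E),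
    IsEssential f ∧ Module.length A E = n}
  have hmem : ∀ (E : ModuleCat.{u} A) (f : L →ₗ[A] E), IsEssential f →
      ∃ n ∈ S, Module.length A E = n := fun E f hf => by
    obtain ⟨n, hn⟩ := ENat.ne_top_iff_exists.1 (ne_top_of_le_ne_top (by simp) (hB E f hf))
    exact ⟨n, ⟨E, f, hf, hn.symm⟩, hn.symm⟩
  have hSne : S.Nonempty := by
    obtain ⟨n, hn, -⟩ := hmem L LinearMap.id
      ⟨Function.injective_id, fun x hx => ⟨1, by simpa using hx, by simp⟩⟩
    exact ⟨n, hn⟩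
  have hSb : BddAbove S := ⟨B, fun n ⟨E, f, hf, hn⟩ => by
    have := hB E f hf
    rw [hn] at this
    exact_mod_cast this⟩
  obtain ⟨E, f, hf, hE⟩ := Nat.sSup_mem hSne hSb
  have hfl : IsFiniteLength A E := Module.length_ne_top_iff.1 (by rw [hE]; simp)
  have hnoeth := (isFiniteLength_iff_isNoetherian_isArtinian.1 hfl).1
  refine ⟨E, f, inferInstance, ?_, hf.1⟩
  have : EnoughInjectives (ModuleCat.{u} A) := ModuleCat.enoughInjectives.{u, u} A
  let Q : ModuleCat.{u} A := Injective.under E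
  have hQ : Module.Injective A Q :=
    (Module.injective_iff_injective_object A Q).2 (inferInstanceAs (Injective (Injective.under E)))
  let ι : E →ₗ[A] Q := (Injective.ι E).hom
  have hι : Function.Injective ι := (ModuleCat.mono_iff_injective (Injective.ι E)).1 inferInstance
  obtain ⟨C, -, hC⟩ := zorn_le_nonempty₀ {C : Submodule A Q | ∀ x, ι x ∈ C → x = 0}
    (fun c hc hch y hy => ⟨sSup c, fun x hx => by
      obtain ⟨D, hD, hxD⟩ := (Submodule.mem_sSup_of_directed ⟨y, hy⟩ hch.directedOn).1 hx
      exact hc hD x hxD, fun z hz => le_sSup hz⟩) ⊥ (fun x hx => hι (by simpa using hx))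
  let g : E →ₗ[A] Q ⧸ C := C.mkQ ∘ₗ ι
  have hg : IsEssential g := by
    refine ⟨(injective_iff_map_eq_zero g).2 fun x hx =>
      hC.prop x ((Submodule.Quotient.mk_eq_zero C).1 hx), fun y hy => ?_⟩
    obtain ⟨q, rfl⟩ := C.mkQ_surjective y
    have hq : q ∉ C := fun h => hy ((Submodule.Quotient.mk_eq_zero C).2 h)
    by_contra! hcon
    refine hq (hC.le_of_ge (y := C ⊔ Submodule.span A {q}) (fun x hx => ?_) le_sup_left
      (Submodule.mem_sup_right (Submodule.mem_span_singleton_self q)))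
    obtain ⟨c, hc, d, hd, hcd⟩ := Submodule.mem_sup.1 hx
    obtain ⟨a, rfl⟩ := Submodule.mem_span_singleton.1 hd
    have h1 : a • C.mkQ q = g x := by
      change C.mkQ (a • q) = C.mkQ (ι x)
      rw [← hcd, map_add, show C.mkQ c = 0 from (Submodule.Quotient.mk_eq_zero C).2 hc, zero_add]
    have h2 : a • C.mkQ q = 0 := by_contra fun h => hcon a h ⟨x, h1.symm⟩
    exact hC.prop x ((Submodule.Quotient.mk_eq_zero C).1 (h1.symm.trans h2))
  have hsurj : Function.Surjective g := by
    obtain ⟨n, hn, hlen⟩ := hmem (ModuleCat.of A (Q ⧸ C)) (g ∘ₗ f) (hg.comp hf)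
    have hadd := Module.length_eq_add_of_exact g (LinearMap.range g).mkQ hg.1
      (Submodule.mkQ_surjective _) (LinearMap.exact_map_mkQ_range g)
    have hle : n ≤ sSup S := le_csSup hSb hn
    have hlen' : Module.length A (Q ⧸ C) = n := hlen
    rw [hlen', hE] at hadd
    have h0 : Module.length A ((Q ⧸ C) ⧸ LinearMap.range g) = 0 := by
      obtain ⟨m, hm⟩ := ENat.ne_top_iff_exists.1
        (show Module.length A ((Q ⧸ C) ⧸ LinearMap.range g) ≠ ⊤ by
          intro h; rw [h] at hadd; simp at hadd)
      rw [← hm] at hadd ⊢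
      norm_cast at hadd ⊢
      omega
    rw [Module.length_eq_zero_iff, Submodule.Quotient.subsingleton_iff] at h0
    exact LinearMap.range_eq_top.1 h0
  let e := LinearEquiv.ofBijective g ⟨hg.1, hsurj⟩
  refine ⟨fun X Y _ _ _ _ i hi h => ?_⟩
  obtain ⟨t, ht⟩ := hQ.out i hi (ι ∘ₗ h)
  refine ⟨e.symm.toLinearMap ∘ₗ C.mkQ ∘ₗ t, fun x => ?_⟩
  change e.symm (C.mkQ (t (i x))) = h x
  rw [ht, LinearEquiv.symm_apply_eq]
  rfl

end InjectiveEnvelope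

section ShortExact

variable {A : Type u} [Ring A]

/-- `0 → X → Y → Z → 0` is a short exact sequence of (unbundled) modules. -/
structure ShortExact {X Y Z : Type u} [AddCommGroup X] [Module A X] [AddCommGroup Y] [Module A Y]
    [AddCommGroup Z] [Module A Z] (f : X →ₗ[A] Y) (g : Y →ₗ[A] Z) : Prop where
  injective : Function.Injective f
  surjective : Function.Surjective g
  exact : Function.Exact f g

/-- The product of two families is the family of products. -/
def piProdEquiv {ι : Type} (X Y : ι → Type u) [∀ i, AddCommGroup (X i)] [∀ i, Module A (X i)]
    [∀ i, AddCommGroup (Y i)] [∀ i, Module A (Y i)] :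
    ((∀ i, X i) × (∀ i, Y i)) ≃ₗ[A] (∀ i, X i × Y i) where
  toFun p i := (p.1 i, p.2 i)
  invFun q := (fun i => (q i).1, fun i => (q i).2)
  map_add' _ _ := rfl
  map_smul' _ _ := rfl

variable {X Y Z : Type u} [AddCommGroup X] [Module A X] [AddCommGroup Y] [Module A Y]
  [AddCommGroup Z] [Module A Z] {f : X →ₗ[A] Y} {g : Y →ₗ[A] Z}

namespace ShortExact

theorem comp_eq_zero (h : ShortExact f g) (x : X) : g (f x) = 0 :=
  h.exact.apply_apply_eq_zero x

theorem congr {X' Y' Z' : Type u} [AddCommGroup X'] [Module A X'] [AddCommGroup Y'] [Module A Y']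
    [AddCommGroup Z'] [Module A Z'] (h : ShortExact f g) (a : X' ≃ₗ[A] X) (b : Y ≃ₗ[A] Y')
    (c : Z ≃ₗ[A] Z') :
    ShortExact (b.toLinearMap ∘ₗ f ∘ₗ a.toLinearMap)
      (c.toLinearMap ∘ₗ g ∘ₗ b.symm.toLinearMap) where
  injective := b.injective.comp (h.injective.comp a.injective)
  surjective := c.surjective.comp (h.surjective.comp b.symm.surjective)
  exact y := by
    simp only [LinearMap.comp_apply, LinearEquiv.coe_coe, LinearEquiv.map_eq_zero_iff, Set.mem_range]
    rw [h.exact (b.symm y)]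
    constructor
    · rintro ⟨x, hx⟩
      exact ⟨a.symm x, by simp [hx]⟩
    · rintro ⟨x, rfl⟩
      exact ⟨a x, by simp⟩

theorem prod {X' Y' Z' : Type u} [AddCommGroup X'] [Module A X'] [AddCommGroup Y'] [Module A Y']
    [AddCommGroup Z'] [Module A Z'] {f' : X' →ₗ[A] Y'} {g' : Y' →ₗ[A] Z'} (h : ShortExact f g)
    (h' : ShortExact f' g') : ShortExact (f.prodMap f') (g.prodMap g') where
  injective := h.injective.prodMap h'.injective
  surjective := h.surjective.prodMap h'.surjective
  exact y := by
    obtain ⟨y, y'⟩ := y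
    simp only [LinearMap.prodMap_apply, Prod.mk_eq_zero, Set.mem_range, Prod.exists, Prod.mk.injEq]
    rw [h.exact y, h'.exact y']
    constructor
    · rintro ⟨⟨x, hx⟩, x', hx'⟩
      exact ⟨x, x', hx, hx'⟩
    · rintro ⟨x, x', hx, hx'⟩
      exact ⟨⟨x, hx⟩, x', hx'⟩

theorem pi {ι : Type} {X Y Z : ι → Type u} [∀ i, AddCommGroup (X i)] [∀ i, Module A (X i)]
    [∀ i, AddCommGroup (Y i)] [∀ i, Module A (Y i)] [∀ i, AddCommGroup (Z i)]
    [∀ i, Module A (Z i)] {f : ∀ i, X i →ₗ[A] Y i} {g : ∀ i, Y i →ₗ[A] Z i}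
    (h : ∀ i, ShortExact (f i) (g i)) :
    ShortExact (LinearMap.pi fun i => f i ∘ₗ LinearMap.proj i)
      (LinearMap.pi fun i => g i ∘ₗ LinearMap.proj i) where
  injective x y hxy := funext fun i => (h i).injective (congrFun hxy i)
  surjective z := by
    choose y hy using fun i => (h i).surjective (z i)
    exact ⟨y, funext hy⟩
  exact y := by
    constructor
    · intro hy
      choose x hx using fun i => ((h i).exact (y i)).1 (congrFun hy i)
      exact ⟨x, funext hx⟩
    · rintro ⟨x, rfl⟩
      exact funext fun i => (h i).comp_eq_zero (x i)

theorem of_equiv_left [Subsingleton Z] (e : X ≃ₗ[A] Y) :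
    ShortExact e.toLinearMap (0 : Y →ₗ[A] Z) where
  injective := e.injective
  surjective _ := ⟨0, Subsingleton.elim _ _⟩
  exact y := ⟨fun _ => e.surjective y, fun _ => rfl⟩

theorem of_equiv_right [Subsingleton X] (e : Y ≃ₗ[A] Z) :
    ShortExact (0 : X →ₗ[A] Y) e.toLinearMap where
  injective := Function.injective_of_subsingleton _
  surjective := e.surjective
  exact y := by
    constructor
    · intro h
      exact ⟨0, by rw [map_zero]; exact ((LinearEquiv.map_eq_zero_iff e).1 h).symm⟩
    · rintro ⟨x, rfl⟩
      simp

theorem exists_equiv_of_subsingleton (h : ShortExact f g) [Subsingleton Z] :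
    Nonempty (X ≃ₗ[A] Y) :=
  ⟨LinearEquiv.ofBijective f ⟨h.injective, fun y => (h.exact y).1 (Subsingleton.elim _ _)⟩⟩

theorem of_surjective (hg : Function.Surjective g) :
    ShortExact (LinearMap.ker g).subtype g where
  injective := Submodule.subtype_injective _
  surjective := hg
  exact := LinearMap.exact_subtype_ker_map g

theorem of_injective (hf : Function.Injective f) :
    ShortExact f (LinearMap.range f).mkQ where
  injective := hf
  surjective := Submodule.mkQ_surjective _
  exact := LinearMap.exact_map_mkQ_range f

/-- Maps killed by `g` factor through `f`. -/
theorem exists_lift (h : ShortExact f g) {W : Type u} [AddCommGroup W] [Module A W]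
    (u : W →ₗ[A] Y) (hu : ∀ w, g (u w) = 0) : ∃ v : W →ₗ[A] X, ∀ w, f (v w) = u w := by
  refine ⟨(LinearEquiv.ofInjective f h.injective).symm.toLinearMap ∘ₗ
    u.codRestrict (LinearMap.range f) (fun w => (h.exact (u w)).1 (hu w)), fun w => ?_⟩
  have := congrArg Subtype.val ((LinearEquiv.ofInjective f h.injective).apply_symm_apply
    (u.codRestrict (LinearMap.range f) (fun w => (h.exact (u w)).1 (hu w)) w))
  exact this

/-- Maps killing `f` factor through `g`. -/
theorem exists_desc (h : ShortExact f g) {W : Type u} [AddCommGroup W] [Module A W]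
    (u : Y →ₗ[A] W) (hu : ∀ x, u (f x) = 0) : ∃ v : Z →ₗ[A] W, ∀ y, v (g y) = u y := by
  have hle : LinearMap.ker g ≤ LinearMap.ker u := fun y hy => by
    obtain ⟨x, rfl⟩ := (h.exact y).1 hy
    exact hu x
  refine ⟨(LinearMap.ker g).liftQ u hle ∘ₗ
    (g.quotKerEquivOfSurjective h.surjective).symm.toLinearMap, fun y => ?_⟩
  have : (g.quotKerEquivOfSurjective h.surjective).symm (g y) = (LinearMap.ker g).mkQ y := by
    rw [LinearEquiv.symm_apply_eq]
    rfl
  rw [LinearMap.comp_apply, LinearEquiv.coe_coe, this]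
  rfl

theorem finite (h : ShortExact f g) [Module.Finite A X] [Module.Finite A Z] : Module.Finite A Y := by
  have : Module.Finite A (LinearMap.ker g) := by
    rw [h.exact.linearMap_ker_eq]
    infer_instance
  have : Module.Finite A (Y ⧸ LinearMap.ker g) :=
    Module.Finite.equiv (g.quotKerEquivOfSurjective h.surjective).symm
  exact Module.Finite.of_submodule_quotient (LinearMap.ker g)

/-- A map onto the third term of a short exact sequence from a projective module gives a map onto
the middle term with the same kernel. -/
theorem exists_surjective_of_projective (h : ShortExact f g) {K P : Type u} [AddCommGroup K]
    [Module A K] [AddCommGroup P] [Module A P] [Module.Projective A P] {i : K →ₗ[A] P}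
    {π : P →ₗ[A] Z} (hP : ShortExact i π) :
    ∃ q : (X × P) →ₗ[A] Y, Function.Surjective q ∧ Nonempty (LinearMap.ker q ≃ₗ[A] K) := by
  obtain ⟨s, hs⟩ := Module.projective_lifting_property g π h.surjective
  replace hs : ∀ p, g (s p) = π p := fun p => LinearMap.congr_fun hs p
  refine ⟨f.coprod s, fun y => ?_, ?_⟩
  · obtain ⟨p, hp⟩ := hP.surjective (g y)
    obtain ⟨x, hx⟩ := (h.exact (y - s p)).1 (by rw [map_sub, hs, hp, sub_self])
    exact ⟨(x, p), by simp [hx]⟩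
  · obtain ⟨v, hv⟩ := hP.exists_lift (LinearMap.snd A X P ∘ₗ (LinearMap.ker (f.coprod s)).subtype)
      (fun w => by
        have h0 : f w.1.1 + s w.1.2 = 0 := w.2
        have := congrArg g h0
        simpa [h.comp_eq_zero, hs] using this)
    replace hv : ∀ w : LinearMap.ker (f.coprod s), i (v w) = w.1.2 := hv
    refine ⟨LinearEquiv.ofBijective v ⟨(injective_iff_map_eq_zero v).2 fun w hw => ?_, fun k => ?_⟩⟩
    · have h2 : w.1.2 = 0 := by rw [← hv, hw, map_zero]
      have h0 : f w.1.1 + s w.1.2 = 0 := w.2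
      rw [h2, map_zero, add_zero] at h0
      have h1 : w.1.1 = 0 := h.injective (by rw [h0, map_zero])
      exact Subtype.ext (Prod.ext h1 h2)
    · obtain ⟨x, hx⟩ := (h.exact (s (i k))).1 (by rw [hs, hP.comp_eq_zero])
      exact ⟨⟨(-x, i k), by simp [hx]⟩, hP.injective (hv _)⟩

/-- An embedding of the first term of a short exact sequence into an injective module gives an
embedding of the middle term with the same cokernel. -/
theorem exists_shortExact_of_injective (h : ShortExact f g) {J C : Type u} [AddCommGroup J]
    [Module A J] [AddCommGroup C] [Module A C] [Module.Injective A J] {i : X →ₗ[A] J}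
    {π : J →ₗ[A] C} (hJ : ShortExact i π) :
    ∃ (a : Y →ₗ[A] Z × J) (b : (Z × J) →ₗ[A] C), ShortExact a b := by
  obtain ⟨e, he⟩ := Module.Injective.out f h.injective i
  obtain ⟨d, hd⟩ := h.exists_desc (π ∘ₗ e) (fun x => by simp [he, hJ.comp_eq_zero])
  replace hd : ∀ y, d (g y) = π (e y) := hd
  refine ⟨g.prod e, π ∘ₗ LinearMap.snd A Z J - d ∘ₗ LinearMap.fst A Z J,
    (injective_iff_map_eq_zero _).2 fun y hy => ?_, fun c => ?_, fun zj => ⟨fun hzj => ?_, ?_⟩⟩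
  · obtain ⟨hg, hee⟩ := Prod.mk.inj hy
    obtain ⟨x, rfl⟩ := (h.exact y).1 hg
    have hx : i x = 0 := by rw [← he]; exact hee
    rw [hJ.injective (hx.trans (map_zero i).symm), map_zero]
  · obtain ⟨j, rfl⟩ := hJ.surjective c
    exact ⟨(0, j), by simp⟩
  · obtain ⟨z, j⟩ := zj
    obtain ⟨y, rfl⟩ := h.surjective z
    have h0 : π j - d (g y) = 0 := hzj
    obtain ⟨x, hx⟩ := (hJ.exact (j - e y)).1 (by rw [map_sub, ← hd, h0])
    exact ⟨y + f x, Prod.ext (by simp [h.comp_eq_zero]) (by simp [he, hx])⟩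
  · rintro ⟨y, rfl⟩
    simp [hd]

/-- The horseshoe lemma for projective presentations. -/
theorem horseshoe_projective (h : ShortExact f g) {K P K' P' : Type u} [AddCommGroup K]
    [Module A K] [AddCommGroup P] [Module A P] [AddCommGroup K'] [Module A K'] [AddCommGroup P']
    [Module A P'] [Module.Projective A P'] {i : K →ₗ[A] P} {π : P →ₗ[A] X}
    (hP : ShortExact i π) {i' : K' →ₗ[A] P'} {π' : P' →ₗ[A] Z} (hP' : ShortExact i' π') :
    ∃ q : (P × P') →ₗ[A] Y, Function.Surjective q ∧
      ∃ (a : K →ₗ[A] LinearMap.ker q) (b : LinearMap.ker q →ₗ[A] K'), ShortExact a b := by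
  obtain ⟨s, hs⟩ := Module.projective_lifting_property g π' h.surjective
  replace hs : ∀ p, g (s p) = π' p := fun p => LinearMap.congr_fun hs p
  refine ⟨(f ∘ₗ π).coprod s, fun y => ?_, ?_⟩
  · obtain ⟨p', hp'⟩ := hP'.surjective (g y)
    obtain ⟨x, hx⟩ := (h.exact (y - s p')).1 (by rw [map_sub, hs, hp', sub_self])
    obtain ⟨p, rfl⟩ := hP.surjective x
    exact ⟨(p, p'), by simp [hx]⟩
  · obtain ⟨b, hb⟩ := hP'.exists_lift
      (LinearMap.snd A P P' ∘ₗ (LinearMap.ker ((f ∘ₗ π).coprod s)).subtype) (fun w => by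
        have h0 : f (π w.1.1) + s w.1.2 = 0 := w.2
        have := congrArg g h0
        simpa [h.comp_eq_zero, hs] using this)
    replace hb : ∀ w : LinearMap.ker ((f ∘ₗ π).coprod s), i' (b w) = w.1.2 := hb
    refine ⟨(LinearMap.inl A P P' ∘ₗ i).codRestrict _ (fun k => by simp [hP.comp_eq_zero]), b,
      (injective_iff_map_eq_zero _).2 fun k hk => ?_, fun k => ?_, fun w => ⟨fun hw => ?_, ?_⟩⟩
    · have : i k = 0 := congrArg (fun w : LinearMap.ker ((f ∘ₗ π).coprod s) => w.1.1) hk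
      exact hP.injective (this.trans (map_zero i).symm)
    · obtain ⟨x, hx⟩ := (h.exact (s (i' k))).1 (by rw [hs, hP'.comp_eq_zero])
      obtain ⟨p, rfl⟩ := hP.surjective x
      exact ⟨⟨(-p, i' k), by simp [hx]⟩, hP'.injective (hb _)⟩
    · have h2 : w.1.2 = 0 := by rw [← hb, hw, map_zero]
      have h0 : f (π w.1.1) + s w.1.2 = 0 := w.2
      rw [h2, map_zero, add_zero] at h0
      obtain ⟨k, hk⟩ := (hP.exact w.1.1).1 (h.injective (h0.trans (map_zero f).symm))
      exact ⟨k, Subtype.ext (Prod.ext hk h2.symm)⟩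
    · rintro ⟨k, rfl⟩
      exact hP'.injective ((hb _).trans (map_zero i').symm)

/-- The horseshoe lemma for injective copresentations. -/
theorem horseshoe_injective (h : ShortExact f g) {J C J' C' : Type u} [AddCommGroup J]
    [Module A J] [AddCommGroup C] [Module A C] [AddCommGroup J'] [Module A J'] [AddCommGroup C']
    [Module A C'] [Module.Injective A J] {i : X →ₗ[A] J} {π : J →ₗ[A] C}
    (hJ : ShortExact i π) {i' : Z →ₗ[A] J'} {π' : J' →ₗ[A] C'} (hJ' : ShortExact i' π') :
    ∃ r : Y →ₗ[A] J × J', Function.Injective r ∧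
      ∃ (a : C →ₗ[A] (J × J') ⧸ LinearMap.range r) (b : ((J × J') ⧸ LinearMap.range r) →ₗ[A] C'),
        ShortExact a b := by
  obtain ⟨e, he⟩ := Module.Injective.out f h.injective i
  let r : Y →ₗ[A] J × J' := e.prod (i' ∘ₗ g)
  have hr : Function.Injective r := (injective_iff_map_eq_zero _).2 fun y hy => by
    obtain ⟨h1, h2⟩ := Prod.mk.inj hy
    obtain ⟨x, rfl⟩ := (h.exact y).1 (hJ'.injective (h2.trans (map_zero i').symm))
    have hx : i x = 0 := by rw [← he]; exact h1
    rw [hJ.injective (hx.trans (map_zero i).symm), map_zero]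
  have hq := of_injective hr
  obtain ⟨a, ha⟩ := hJ.exists_desc ((LinearMap.range r).mkQ ∘ₗ LinearMap.inl A J J') (fun x => by
    refine (hq.exact _).2 ⟨f x, Prod.ext (he x) ?_⟩
    change i' (g (f x)) = 0
    rw [h.comp_eq_zero, map_zero])
  obtain ⟨b, hb⟩ := hq.exists_desc (π' ∘ₗ LinearMap.snd A J J') (fun y => hJ'.comp_eq_zero (g y))
  replace ha : ∀ j, a (π j) = (LinearMap.range r).mkQ (j, 0) := ha
  replace hb : ∀ p, b ((LinearMap.range r).mkQ p) = π' p.2 := hb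
  refine ⟨r, hr, a, b, (injective_iff_map_eq_zero _).2 fun c hc => ?_, fun c => ?_,
    fun z => ⟨fun hz => ?_, ?_⟩⟩
  · obtain ⟨j, rfl⟩ := hJ.surjective c
    rw [ha] at hc
    obtain ⟨y, hy⟩ := (hq.exact _).1 hc
    obtain ⟨h1, h2⟩ := Prod.mk.inj hy
    obtain ⟨x, rfl⟩ := (h.exact y).1 (hJ'.injective (h2.trans (map_zero i').symm))
    have hx : i x = j := by rw [← he]; exact h1
    rw [← hx, hJ.comp_eq_zero]
  · obtain ⟨j', rfl⟩ := hJ'.surjective c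
    exact ⟨_, hb (0, j')⟩
  · obtain ⟨⟨j, j'⟩, rfl⟩ := hq.surjective z
    rw [hb] at hz
    obtain ⟨z, rfl⟩ := (hJ'.exact j').1 hz
    obtain ⟨y, rfl⟩ := h.surjective z
    refine ⟨π (j - e y), ?_⟩
    rw [ha, ← sub_eq_zero, ← map_sub]
    exact (hq.exact _).2 ⟨-y, Prod.ext (by simp [r]) (by simp [r])⟩
  · rintro ⟨c, rfl⟩
    obtain ⟨j, rfl⟩ := hJ.surjective c
    rw [ha, hb, map_zero]

end ShortExact

end ShortExact

section Add

variable {A : Type u} [Ring A]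

theorem memAdd_of_mem {S : Set (ModuleCat.{u} A)} {X : ModuleCat.{u} A} (hX : X ∈ S) :
    memAdd A S X :=
  ⟨1, fun _ => X, ModuleCat.of A PUnit.{u + 1}, fun _ => hX,
    ⟨LinearEquiv.prodUnique ≪≫ₗ (LinearEquiv.funUnique (Fin 1) A X).symm⟩⟩

theorem memAdd_of_prod {S : Set (ModuleCat.{u} A)} {X Y : ModuleCat.{u} A}
    (h : memAdd A S (ModuleCat.of A (X × Y))) : memAdd A S X := by
  obtain ⟨n, M, Z, hM, ⟨e⟩⟩ := h
  exact ⟨n, M, ModuleCat.of A (Y × Z), hM, ⟨(LinearEquiv.prodAssoc A X Y Z).symm ≪≫ₗ e⟩⟩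

theorem mem_addOf_iff {T X : ModuleCat.{u} A} :
    X ∈ addOf A T ↔ ∃ (ι : Type) (_ : Finite ι) (Y : ModuleCat.{u} A),
      Nonempty ((X × Y) ≃ₗ[A] (ι → T)) := by
  constructor
  · rintro ⟨n, M, Y, hM, ⟨e⟩⟩
    obtain rfl : M = fun _ => T := funext hM
    exact ⟨Fin n, inferInstance, Y, ⟨e⟩⟩
  · rintro ⟨ι, _, Y, ⟨e⟩⟩
    exact ⟨Nat.card ι, fun _ => T, Y, fun _ => rfl,
      ⟨e ≪≫ₗ LinearEquiv.funCongrLeft A T (Finite.equivFin ι).symm⟩⟩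

theorem addOf_congr {T X X' : ModuleCat.{u} A} (e : X ≃ₗ[A] X') (h : X ∈ addOf A T) :
    X' ∈ addOf A T := by
  obtain ⟨ι, hι, Y, ⟨f⟩⟩ := mem_addOf_iff.1 h
  exact mem_addOf_iff.2 ⟨ι, hι, Y, ⟨e.symm.prodCongr (LinearEquiv.refl A Y) ≪≫ₗ f⟩⟩

theorem addOf_of_prod {T X Y : ModuleCat.{u} A} (h : ModuleCat.of A (X × Y) ∈ addOf A T) :
    X ∈ addOf A T :=
  memAdd_of_prod h

theorem self_mem_addOf (T : ModuleCat.{u} A) : T ∈ addOf A T :=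
  memAdd_of_mem rfl

theorem addOf_of_subsingleton (T X : ModuleCat.{u} A) [Subsingleton X] : X ∈ addOf A T :=
  mem_addOf_iff.2 ⟨Empty, inferInstance, ModuleCat.of A PUnit.{u + 1},
    ⟨(LinearEquiv.ofSubsingleton (X × PUnit.{u + 1}) (Empty → T))⟩⟩

theorem addOf_pi {T : ModuleCat.{u} A} {κ : Type} [Finite κ] {X : κ → ModuleCat.{u} A}
    (h : ∀ i, X i ∈ addOf A T) : ModuleCat.of A (∀ i, X i) ∈ addOf A T := by
  choose ι hι Y e using fun i => mem_addOf_iff.1 (h i)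
  exact mem_addOf_iff.2 ⟨Σ i, ι i, inferInstance, ModuleCat.of A (∀ i, Y i),
    ⟨piProdEquiv (fun i => X i) (fun i => Y i) ≪≫ₗ
      LinearEquiv.piCongrRight (fun i => (e i).some) ≪≫ₗ
      (LinearEquiv.piCurry A fun (i : κ) (_ : ι i) => (T : Type u)).symm⟩⟩

theorem addOf_prod {T X Y : ModuleCat.{u} A} (hX : X ∈ addOf A T) (hY : Y ∈ addOf A T) :
    ModuleCat.of A (X × Y) ∈ addOf A T := by
  obtain ⟨ι, hι, X', ⟨e⟩⟩ := mem_addOf_iff.1 hX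
  obtain ⟨κ, hκ, Y', ⟨f⟩⟩ := mem_addOf_iff.1 hY
  exact mem_addOf_iff.2 ⟨ι ⊕ κ, inferInstance, ModuleCat.of A (X' × Y'),
    ⟨LinearEquiv.prodProdProdComm A X Y X' Y' ≪≫ₗ e.prodCongr f ≪≫ₗ
      (LinearEquiv.sumArrowLequivProdArrow ι κ A T).symm⟩⟩

theorem addOf_trans {T U X : ModuleCat.{u} A} (hX : X ∈ addOf A T) (hT : T ∈ addOf A U) :
    X ∈ addOf A U := by
  obtain ⟨ι, hι, Y, ⟨e⟩⟩ := mem_addOf_iff.1 hX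
  have := addOf_pi (κ := ι) (X := fun _ => T) fun _ => hT
  exact addOf_of_prod (Y := Y) (addOf_congr (X' := ModuleCat.of A (X × Y)) e.symm this)

theorem left_mem_addOf_prod (T U : ModuleCat.{u} A) : T ∈ addOf A (ModuleCat.of A (T × U)) :=
  addOf_of_prod (Y := U) (self_mem_addOf _)

theorem right_mem_addOf_prod (T U : ModuleCat.{u} A) : U ∈ addOf A (ModuleCat.of A (T × U)) :=
  addOf_of_prod (Y := T) (addOf_congr (X' := ModuleCat.of A (U × T)) (LinearEquiv.prodComm A T U)
    (self_mem_addOf _))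

theorem finite_of_mem_addOf {T X : ModuleCat.{u} A} [Module.Finite A T] (h : X ∈ addOf A T) :
    Module.Finite A X := by
  obtain ⟨ι, hι, Y, ⟨e⟩⟩ := mem_addOf_iff.1 h
  exact Module.Finite.of_surjective (LinearMap.fst A X Y ∘ₗ e.symm.toLinearMap)
    ((LinearMap.fst_surjective (R := A)).comp e.symm.surjective)

end Add

section Filtration

variable {A : Type u} [Ring A]

/-- `X` has a filtration whose factors are finite powers of the members of the list, the first
member corresponding to the bottom of the filtration. -/
def Filtered : List (ModuleCat.{u} A) → ModuleCat.{u} A → Prop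
  | [], X => Subsingleton X
  | T :: l, X => ∃ (ι : Type) (_ : Finite ι) (X' : ModuleCat.{u} A) (f : (ι → T) →ₗ[A] X)
      (g : X →ₗ[A] X'), ShortExact f g ∧ Filtered l X'

theorem Filtered.congr {l : List (ModuleCat.{u} A)} {X X' : ModuleCat.{u} A} (e : X ≃ₗ[A] X')
    (h : Filtered l X) : Filtered l X' := by
  cases l with
  | nil =>
    have : Subsingleton X := h
    exact e.symm.toEquiv.subsingleton
  | cons T l =>
    obtain ⟨ι, hι, X'', f, g, hfg, hX''⟩ := h
    exact ⟨ι, hι, X'', _, _, hfg.congr (LinearEquiv.refl A _) e (LinearEquiv.refl A _), hX''⟩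

theorem Filtered.pi {l : List (ModuleCat.{u} A)} {κ : Type} [Finite κ] {X : κ → ModuleCat.{u} A}
    (h : ∀ i, Filtered l (X i)) : Filtered l (ModuleCat.of A (∀ i, X i)) := by
  induction l generalizing X with
  | nil =>
    have : ∀ i, Subsingleton (X i) := h
    exact (inferInstance : Subsingleton (∀ i, X i))
  | cons T l ih =>
    choose ι hι X' f g hfg hX' using h
    exact ⟨Σ i, ι i, inferInstance, ModuleCat.of A (∀ i, X' i), _, _,
      (ShortExact.pi hfg).congr (LinearEquiv.piCurry A fun (i : κ) (_ : ι i) => (T : Type u))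
        (LinearEquiv.refl A _) (LinearEquiv.refl A _), ih hX'⟩

theorem Filtered.finite {l : List (ModuleCat.{u} A)} (hl : ∀ T ∈ l, Module.Finite A T)
    {X : ModuleCat.{u} A} (h : Filtered l X) : Module.Finite A X := by
  induction l generalizing X with
  | nil =>
    have : Subsingleton X := h
    infer_instance
  | cons T l ih =>
    obtain ⟨ι, hι, X', f, g, hfg, hX'⟩ := h
    have := hl T (by simp)
    have := ih (fun T hT => hl T (by simp [hT])) hX'
    exact hfg.finite

theorem exists_filtered_of_mem_bracket {T : ModuleCat.{u} A} {n : ℕ} {X : ModuleCat.{u} A}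
    (h : X ∈ bracket A T (n + 1)) :
    ∃ Y : ModuleCat.{u} A, Filtered (List.replicate (n + 1) T) (ModuleCat.of A (X × Y)) := by
  induction n generalizing X with
  | zero =>
    obtain ⟨ι, hι, Y, ⟨e⟩⟩ := mem_addOf_iff.1 h
    exact ⟨Y, ι, hι, ModuleCat.of A PUnit.{u + 1}, _, _, ShortExact.of_equiv_left e.symm,
      inferInstanceAs (Subsingleton PUnit.{u + 1})⟩
  | succ n ih =>
    obtain ⟨m, W, Y, hW, ⟨e⟩⟩ := h
    have key : ∀ i, ∃ V : ModuleCat.{u} A,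
        Filtered (List.replicate (n + 2) T) (ModuleCat.of A (W i × V)) := fun i => by
      obtain ⟨-, T₁, T₂, f, g, h₁, h₂, hf, hg, hfg⟩ := hW i
      obtain ⟨ι, hι, C, ⟨d⟩⟩ := mem_addOf_iff.1 h₁
      obtain ⟨Z, hZ⟩ := ih h₂
      have hs : ShortExact f g := ⟨hf, hg, LinearMap.exact_iff.2 hfg.symm⟩
      have hC : ShortExact (LinearEquiv.refl A C).toLinearMap (0 : C →ₗ[A] PUnit.{u + 1}) :=
        ShortExact.of_equiv_left _
      have hZ' : ShortExact (0 : PUnit.{u + 1} →ₗ[A] Z) (LinearEquiv.refl A Z).toLinearMap :=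
        ShortExact.of_equiv_right _
      have := (hs.prod (hC.prod hZ')).congr
        (d.symm ≪≫ₗ (LinearEquiv.refl A T₁).prodCongr (LinearEquiv.prodUnique).symm)
        (LinearEquiv.refl A _)
        ((LinearEquiv.refl A T₂).prodCongr (LinearEquiv.uniqueProd))
      exact ⟨ModuleCat.of A (C × Z), ι, hι, ModuleCat.of A (T₂ × Z), _, _, this, hZ⟩
    choose V hV using key
    exact ⟨ModuleCat.of A (Y × ∀ i, V i), (Filtered.pi hV).congr
      ((piProdEquiv (fun i => W i) (fun i => V i)).symm ≪≫ₗ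
        e.symm.prodCongr (LinearEquiv.refl A _) ≪≫ₗ LinearEquiv.prodAssoc A X Y (∀ i, V i))⟩

theorem mem_bracket_of_prod {T : ModuleCat.{u} A} {n : ℕ} {X Y : ModuleCat.{u} A}
    (h : ModuleCat.of A (X × Y) ∈ bracket A T (n + 1)) : X ∈ bracket A T (n + 1) := by
  cases n with
  | zero => exact memAdd_of_prod h
  | succ n => exact memAdd_of_prod h

theorem Filtered.mem_bracket {U : ModuleCat.{u} A} [Module.Finite A U] {n : ℕ}
    {l : List (ModuleCat.{u} A)} (hlen : l.length = n + 1) (hl : ∀ T ∈ l, T ∈ addOf A U)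
    {X : ModuleCat.{u} A} (h : Filtered l X) : X ∈ bracket A U (n + 1) := by
  have hX := h.finite fun T hT => finite_of_mem_addOf (hl T hT)
  induction n generalizing l X with
  | zero =>
    obtain ⟨T, rfl⟩ := List.length_eq_one_iff.1 hlen
    obtain ⟨ι, hι, X', f, g, hfg, hX'⟩ := h
    have : Subsingleton X' := hX'
    obtain ⟨e⟩ := hfg.exists_equiv_of_subsingleton
    exact addOf_congr (X := ModuleCat.of A (ι → T)) e (addOf_pi fun _ => hl T (by simp))
  | succ n ih =>
    obtain ⟨T, l, rfl⟩ := List.exists_cons_of_length_eq_add_one hlen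
    obtain ⟨ι, hι, X', f, g, hfg, hX'⟩ := h
    have hl' : ∀ T ∈ l, T ∈ addOf A U := fun T hT => hl T (by simp [hT])
    refine memAdd_of_mem ⟨hX, ModuleCat.of A (ι → T), X', f, g, addOf_pi fun _ => hl T (by simp),
      ih (by simpa using hlen) hl' hX' (hX'.finite fun T hT => finite_of_mem_addOf (hl' T hT)),
      hfg.injective, hfg.surjective, (LinearMap.exact_iff.1 hfg.exact).symm⟩

theorem exists_finite_forall_mem_addOf {l : List (ModuleCat.{u} A)}
    (hl : ∀ T ∈ l, Module.Finite A T) :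
    ∃ U : ModuleCat.{u} A, Module.Finite A U ∧ ∀ T ∈ l, T ∈ addOf A U := by
  induction l with
  | nil => exact ⟨ModuleCat.of A PUnit.{u + 1}, inferInstanceAs (Module.Finite A PUnit.{u + 1}), by simp⟩
  | cons T l ih =>
    obtain ⟨U, hU, hlU⟩ := ih fun T hT => hl T (by simp [hT])
    have := hl T (by simp)
    refine ⟨ModuleCat.of A (T × U), inferInstanceAs (Module.Finite A (T × U)), fun S hS => ?_⟩
    rcases List.mem_cons.1 hS with rfl | hS
    · exact left_mem_addOf_prod _ _
    · exact addOf_trans (hlU S hS) (right_mem_addOf_prod _ _)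

theorem exists_syzygy [IsNoetherianRing A] {l : List (ModuleCat.{u} A)}
    (hl : ∀ T ∈ l, Module.Finite A T) :
    ∃ l' : List (ModuleCat.{u} A), l'.length = l.length ∧ (∀ T ∈ l', Module.Finite A T) ∧
      ∀ X, Filtered l X → ∃ (P K : ModuleCat.{u} A) (i : K →ₗ[A] P) (π : P →ₗ[A] X),
        ShortExact i π ∧ Filtered l' K ∧ P ∈ addOf A (ModuleCat.of A A) ∧
          Module.Projective A P := by
  induction l with
  | nil =>
    refine ⟨[], rfl, by simp, fun X hX => ?_⟩
    have : Subsingleton X := hX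
    exact ⟨ModuleCat.of A PUnit.{u + 1}, ModuleCat.of A PUnit.{u + 1}, _, _,
      ShortExact.of_equiv_left (Z := X) (LinearEquiv.refl A PUnit.{u + 1}),
      inferInstanceAs (Subsingleton PUnit.{u + 1}), addOf_of_subsingleton _ _,
      inferInstanceAs (Module.Projective A PUnit.{u + 1})⟩
  | cons T l ih =>
    obtain ⟨l', hlen, hfin, hl'⟩ := ih fun T hT => hl T (by simp [hT])
    have := hl T (by simp)
    obtain ⟨r, p, hp⟩ := Module.Finite.exists_fin' A T
    refine ⟨ModuleCat.of A (LinearMap.ker p) :: l', by simp [hlen], fun S hS => ?_,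
      fun X ⟨ι, hι, X', f, g, hfg, hX'⟩ => ?_⟩
    · rcases List.mem_cons.1 hS with rfl | hS
      · exact inferInstanceAs (Module.Finite A (LinearMap.ker p))
      · exact hfin S hS
    · obtain ⟨P, K, i, π, hs, hK, hP, hproj⟩ := hl' X' hX'
      obtain ⟨q, hq, a, b, hab⟩ := hfg.horseshoe_projective
        (ShortExact.pi fun _ : ι => ShortExact.of_surjective hp) hs
      exact ⟨ModuleCat.of A ((ι → Fin r → A) × P), ModuleCat.of A (LinearMap.ker q), _, _,
        ShortExact.of_surjective hq, ⟨ι, hι, K, a, b, hab, hK⟩,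
        addOf_prod (X := ModuleCat.of A (ι → Fin r → A))
          (addOf_pi (X := fun _ => ModuleCat.of A (Fin r → A)) fun _ =>
            addOf_pi (X := fun _ => ModuleCat.of A A) fun _ => self_mem_addOf _) hP,
        inferInstanceAs (Module.Projective A ((ι → Fin r → A) × P))⟩

theorem injective_prod {X Y : Type u} [AddCommGroup X] [Module A X] [AddCommGroup Y] [Module A Y]
    [Module.Injective A X] [Module.Injective A Y] : Module.Injective A (X × Y) :=
  ⟨fun _ _ _ _ _ _ i hi h => by
    obtain ⟨a, ha⟩ := Module.Injective.out i hi (LinearMap.fst A X Y ∘ₗ h)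
    obtain ⟨b, hb⟩ := Module.Injective.out i hi (LinearMap.snd A X Y ∘ₗ h)
    exact ⟨a.prod b, fun x => Prod.ext (ha x) (hb x)⟩⟩

theorem exists_cosyzygy
    (hinj : ∀ (L : ModuleCat.{u} A) [Module.Finite A L], ∃ (E : ModuleCat.{u} A) (f : L →ₗ[A] E),
      Module.Finite A E ∧ Module.Injective A E ∧ Function.Injective f)
    {l : List (ModuleCat.{u} A)} (hl : ∀ T ∈ l, Module.Finite A T) :
    ∃ (l' : List (ModuleCat.{u} A)) (I : ModuleCat.{u} A), l'.length = l.length ∧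
      (∀ T ∈ l', Module.Finite A T) ∧ Module.Finite A I ∧
      ∀ X, Filtered l X → ∃ (J C : ModuleCat.{u} A) (i : X →ₗ[A] J) (π : J →ₗ[A] C),
        ShortExact i π ∧ Filtered l' C ∧ J ∈ addOf A I ∧ Module.Injective A J := by
  induction l with
  | nil =>
    refine ⟨[], ModuleCat.of A PUnit.{u + 1}, rfl, by simp, inferInstanceAs (Module.Finite A PUnit.{u + 1}),
      fun X hX => ?_⟩
    have : Subsingleton X := hX
    exact ⟨ModuleCat.of A PUnit.{u + 1}, ModuleCat.of A PUnit.{u + 1}, _, _,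
      ShortExact.of_equiv_right (X := X) (LinearEquiv.refl A PUnit.{u + 1}),
      inferInstanceAs (Subsingleton PUnit.{u + 1}), addOf_of_subsingleton _ _,
      ⟨fun _ _ _ _ _ _ _ _ _ => ⟨0, fun _ => rfl⟩⟩⟩
  | cons T l ih =>
    obtain ⟨l', I, hlen, hfin, hI, hl'⟩ := ih fun T hT => hl T (by simp [hT])
    have := hl T (by simp)
    obtain ⟨E, p, hE, hEinj, hp⟩ := hinj T
    refine ⟨ModuleCat.of A (E ⧸ LinearMap.range p) :: l', ModuleCat.of A (E × I), by simp [hlen],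
      fun S hS => ?_, inferInstanceAs (Module.Finite A (E × I)),
      fun X ⟨ι, hι, X', f, g, hfg, hX'⟩ => ?_⟩
    · rcases List.mem_cons.1 hS with rfl | hS
      · exact inferInstanceAs (Module.Finite A (E ⧸ LinearMap.range p))
      · exact hfin S hS
    · obtain ⟨J, C, i, π, hs, hC, hJ, hJinj⟩ := hl' X' hX'
      obtain ⟨r, hr, a, b, hab⟩ := hfg.horseshoe_injective
        (ShortExact.pi fun _ : ι => ShortExact.of_injective hp) hs
      exact ⟨ModuleCat.of A ((ι → E) × J), ModuleCat.of A (((ι → E) × J) ⧸ LinearMap.range r), _, _,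
        ShortExact.of_injective hr, ⟨ι, hι, C, a, b, hab, hC⟩,
        addOf_prod (X := ModuleCat.of A (ι → E))
          (addOf_pi (X := fun _ => E) fun _ => left_mem_addOf_prod _ _)
          (addOf_trans hJ (right_mem_addOf_prod _ _)),
        injective_prod⟩

end Filtration

section Resolution

variable {A : Type u} [Ring A]

theorem ResLen.congr {M : ModuleCat.{u} A} {n : ℕ} {X X' : ModuleCat.{u} A} (e : X ≃ₗ[A] X')
    (h : ResLen A M X n) : ResLen A M X' n := by
  cases n with
  | zero => exact addOf_congr e h
  | succ n =>
    obtain ⟨M₀, g, hM₀, hg, hker⟩ := h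
    refine ⟨M₀, e.toLinearMap ∘ₗ g, hM₀, e.surjective.comp hg, ?_⟩
    rw [LinearEquiv.ker_comp]
    exact hker

theorem ResLen.mono {M N : ModuleCat.{u} A} (hMN : M ∈ addOf A N) {n : ℕ} {X : ModuleCat.{u} A}
    (h : ResLen A M X n) : ResLen A N X n := by
  induction n generalizing X with
  | zero => exact addOf_trans h hMN
  | succ n ih =>
    obtain ⟨M₀, g, hM₀, hg, hker⟩ := h
    exact ⟨M₀, g, addOf_trans hM₀ hMN, hg, ih hker⟩

theorem resLen_of_subsingleton (M X : ModuleCat.{u} A) [Subsingleton X] (n : ℕ) :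
    ResLen A M X n := by
  induction n generalizing X with
  | zero => exact addOf_of_subsingleton M X
  | succ n ih =>
    have : Subsingleton (ModuleCat.of A (LinearMap.ker (LinearMap.id : X →ₗ[A] X))) :=
      inferInstanceAs (Subsingleton (LinearMap.ker (LinearMap.id : X →ₗ[A] X)))
    exact ⟨X, LinearMap.id, addOf_of_subsingleton M X, Function.surjective_id, ih _⟩

theorem ResLen.succ {M : ModuleCat.{u} A} {n : ℕ} {X : ModuleCat.{u} A} (h : ResLen A M X n) :
    ResLen A M X (n + 1) := by
  induction n generalizing X with
  | zero =>
    refine ⟨X, LinearMap.id, h, Function.surjective_id, ?_⟩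
    have : Subsingleton (ModuleCat.of A (LinearMap.ker (LinearMap.id : X →ₗ[A] X))) := by
      rw [LinearMap.ker_id]
      exact inferInstanceAs (Subsingleton (⊥ : Submodule A X))
    exact resLen_of_subsingleton _ _ _
  | succ n ih =>
    obtain ⟨M₀, g, hM₀, hg, hker⟩ := h
    exact ⟨M₀, g, hM₀, hg, ih hker⟩

theorem ResLen.of_le {M : ModuleCat.{u} A} {m n : ℕ} (hmn : m ≤ n) {X : ModuleCat.{u} A}
    (h : ResLen A M X m) : ResLen A M X n := by
  induction hmn with
  | refl => exact h
  | step _ ih => exact ih.succ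

theorem exists_resLen_of_filtered [IsNoetherianRing A] {n : ℕ} {l : List (ModuleCat.{u} A)}
    (hlen : l.length = n + 1) (hl : ∀ T ∈ l, Module.Finite A T) :
    ∃ M : ModuleCat.{u} A, Module.Finite A M ∧ ∀ X, Filtered l X → ResLen A M X n := by
  induction n generalizing l with
  | zero =>
    obtain ⟨T, rfl⟩ := List.length_eq_one_iff.1 hlen
    refine ⟨T, hl T (by simp), fun X ⟨ι, hι, X', f, g, hfg, hX'⟩ => ?_⟩
    have : Subsingleton X' := hX'
    obtain ⟨e⟩ := hfg.exists_equiv_of_subsingleton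
    exact addOf_congr (X := ModuleCat.of A (ι → T)) e (addOf_pi fun _ => self_mem_addOf T)
  | succ n ih =>
    obtain ⟨T, l, rfl⟩ := List.exists_cons_of_length_eq_add_one hlen
    obtain ⟨l', hlen', hfin, hl'⟩ := exists_syzygy fun T hT => hl T (List.mem_cons_of_mem _ hT)
    obtain ⟨M, hM, hres⟩ := ih (l := l') (by simpa [hlen'] using hlen) hfin
    have := hl T (by simp)
    refine ⟨ModuleCat.of A (T × ModuleCat.of A (ModuleCat.of A A × M)),
      inferInstanceAs (Module.Finite A (T × A × M)), fun X ⟨ι, hι, X', f, g, hfg, hX'⟩ => ?_⟩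
    obtain ⟨P, K, i, π, hs, hK, hP, hproj⟩ := hl' X' hX'
    obtain ⟨q, hq, ⟨e⟩⟩ := hfg.exists_surjective_of_projective hs
    refine ⟨ModuleCat.of A ((ι → T) × P), q, addOf_prod (X := ModuleCat.of A (ι → T))
      (addOf_pi (X := fun _ => T) fun _ => left_mem_addOf_prod _ _)
      (addOf_trans (addOf_trans hP (left_mem_addOf_prod _ _)) (right_mem_addOf_prod _ _)), hq, ?_⟩
    exact ((hres K hK).mono
      (addOf_trans (right_mem_addOf_prod _ _) (right_mem_addOf_prod _ _))).congr
        (X' := ModuleCat.of A (LinearMap.ker q)) e.symm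

theorem exists_filtered_of_resLen
    (hinj : ∀ (L : ModuleCat.{u} A) [Module.Finite A L], ∃ (E : ModuleCat.{u} A) (f : L →ₗ[A] E),
      Module.Finite A E ∧ Module.Injective A E ∧ Function.Injective f)
    (M : ModuleCat.{u} A) [Module.Finite A M] (n : ℕ) :
    ∃ (l : List (ModuleCat.{u} A)) (U : ModuleCat.{u} A), l.length = n + 1 ∧
      (∀ T ∈ l, Module.Finite A T) ∧ Module.Finite A U ∧ ∀ X, ResLen A M X n →
        ∃ Q ∈ addOf A U, Filtered l (ModuleCat.of A (X × Q)) := by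
  induction n with
  | zero =>
    refine ⟨[M], M, rfl, by simpa, inferInstance, fun X hX => ?_⟩
    obtain ⟨ι, hι, Y, ⟨e⟩⟩ := mem_addOf_iff.1 (show X ∈ addOf A M from hX)
    refine ⟨Y, ?_, ι, hι, ModuleCat.of A PUnit.{u + 1}, _, _, ShortExact.of_equiv_left e.symm,
      inferInstanceAs (Subsingleton PUnit.{u + 1})⟩
    exact mem_addOf_iff.2 ⟨ι, hι, X, ⟨LinearEquiv.prodComm A Y X ≪≫ₗ e⟩⟩
  | succ n ih =>
    obtain ⟨l, U, hlen, hfin, hU, hl⟩ := ih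
    obtain ⟨l', I, hlen', hfin', hI, hl'⟩ := exists_cosyzygy hinj hfin
    let N : ModuleCat.{u} A := ModuleCat.of A (M × U)
    have hN : Module.Finite A N := inferInstanceAs (Module.Finite A (M × U))
    refine ⟨N :: l', ModuleCat.of A (I × N), by simp [hlen', hlen], fun S hS => ?_,
      inferInstanceAs (Module.Finite A (I × N)), fun X ⟨M₀, g, hM₀, hg, hker⟩ => ?_⟩
    · rcases List.mem_cons.1 hS with rfl | hS
      · exact hN
      · exact hfin' S hS
    obtain ⟨Q, hQ, hfil⟩ := hl _ hker
    obtain ⟨J, C, i, π, hs, hC, hJ, hJinj⟩ := hl' _ hfil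
    have hQ' : ShortExact (LinearEquiv.refl A Q).toLinearMap (0 : Q →ₗ[A] PUnit.{u + 1}) :=
      ShortExact.of_equiv_left _
    obtain ⟨a, b, hab⟩ :=
      ((ShortExact.of_surjective hg).prod hQ').exists_shortExact_of_injective hs
    have hMQ : ModuleCat.of A (M₀ × Q) ∈ addOf A N :=
      addOf_prod (addOf_trans hM₀ (left_mem_addOf_prod _ _))
        (addOf_trans hQ (right_mem_addOf_prod _ _))
    obtain ⟨ι, hι, D, ⟨e⟩⟩ := mem_addOf_iff.1 hMQ
    have hD : D ∈ addOf A N :=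
      mem_addOf_iff.2 ⟨ι, hι, ModuleCat.of A (M₀ × Q), ⟨LinearEquiv.prodComm A _ _ ≪≫ₗ e⟩⟩
    have hD' : ShortExact (LinearEquiv.refl A D).toLinearMap (0 : D →ₗ[A] PUnit.{u + 1}) :=
      ShortExact.of_equiv_left _
    refine ⟨ModuleCat.of A (J × D), addOf_prod (addOf_trans hJ (left_mem_addOf_prod _ _))
      (addOf_trans hD (right_mem_addOf_prod _ _)), ι, hι, C, _, _,
      (hab.prod hD').congr e.symm
        (LinearEquiv.prodAssoc A _ _ _ ≪≫ₗ
          (LinearEquiv.prodUnique (R := A) (M := X)).prodCongr (LinearEquiv.refl A (J × D)))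
        LinearEquiv.prodUnique, hC⟩

end Resolution

section Dimension

variable {A : Type u} [Ring A]

theorem wrdAlg_le_iff {M : ModuleCat.{u} A} {n : ℕ} :
    wrdAlg A M ≤ n ↔ ∀ X : ModuleCat.{u} A, Module.Finite A X → wrdLE A M X n := by
  constructor
  · intro h X hX
    have hle : wrdMod A M X ≤ n := by
      refine le_trans ?_ h
      exact le_sSup ⟨X, hX, rfl⟩
    have hne : {d : ℕ∞ | ∃ n : ℕ, d = n ∧ wrdLE A M X n}.Nonempty := by
      by_contra hempty
      rw [wrdMod, Set.not_nonempty_iff_eq_empty.1 hempty, sInf_empty] at hle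
      simp at hle
    obtain ⟨m, hm, Y, hY, hres⟩ := csInf_mem hne
    have hmn : (m : ℕ∞) ≤ n := hm ▸ hle
    exact ⟨Y, hY, hres.of_le (by exact_mod_cast hmn)⟩
  · rintro h
    refine sSup_le ?_
    rintro _ ⟨X, hX, rfl⟩
    exact sInf_le ⟨n, rfl, h X hX⟩

theorem wrd_le_extDim [IsNoetherianRing A] : wrd A ≤ extDim A := by
  refine le_sInf ?_
  rintro _ ⟨n, rfl, T, hT, hX⟩
  have hrep : ∀ S ∈ List.replicate (n + 1) T, Module.Finite A S := fun S hS => by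
    rwa [List.eq_of_mem_replicate hS]
  obtain ⟨M, hM, hres⟩ := exists_resLen_of_filtered (List.length_replicate ..) hrep
  have hle : wrd A ≤ wrdAlg A M := sInf_le ⟨M, hM, rfl⟩
  refine hle.trans (wrdAlg_le_iff.2 fun X hXfin => ?_)
  obtain ⟨Y, hY⟩ := exists_filtered_of_mem_bracket (hX X hXfin)
  have hXY : Module.Finite A (X × Y) := hY.finite hrep
  exact ⟨Y, Module.Finite.of_surjective (LinearMap.snd A X Y) LinearMap.snd_surjective,
    hres _ hY⟩

theorem extDim_le_wrd
    (hinj : ∀ (L : ModuleCat.{u} A) [Module.Finite A L], ∃ (E : ModuleCat.{u} A) (f : L →ₗ[A] E),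
      Module.Finite A E ∧ Module.Injective A E ∧ Function.Injective f) :
    extDim A ≤ wrd A := by
  refine le_sInf ?_
  rintro _ ⟨M, hM, rfl⟩
  by_cases htop : wrdAlg A M = ⊤
  · rw [htop]
    exact le_top
  obtain ⟨n, hn⟩ := ENat.ne_top_iff_exists.1 htop
  obtain ⟨l, U, hlen, hfin, -, hl⟩ := exists_filtered_of_resLen hinj M n
  obtain ⟨T, hT, hlT⟩ := exists_finite_forall_mem_addOf hfin
  rw [← hn]
  refine sInf_le ⟨n, rfl, T, hT, fun X hX => ?_⟩
  obtain ⟨Y, -, hres⟩ := wrdAlg_le_iff.1 hn.ge X hX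
  obtain ⟨Q, -, hQ⟩ := hl _ hres
  exact mem_bracket_of_prod (mem_bracket_of_prod (hQ.mem_bracket hlen hlT))

end Dimension

end Paper

open Paper in
/-- For every Artin algebra `A`, the weak resolution dimension of `A`
equals the extension dimension of `A`. -/
theorem stmt5 (k : Type u) [CommRing k] [IsArtinianRing k]
    (A : Type u) [Ring A] [Algebra k A] [Module.Finite k A] :
    wrd A = extDim A := by
  have : IsArtinianRing A := isArtinian_of_tower k inferInstance
  exact le_antisymm wrd_le_extDim (extDim_le_wrd fun L _ => exists_finite_injective k L)
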